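/- Let μ be a Radon measure on ℝ^d, let f ≥ 0 be measurable, and let w_I ≥ 0, I ∈ 𝒟, satisfy the Carleson measure condition: for every J ∈ 𝒟, Σ_{I∈𝒟, I⊆J} w_I ≤ C μ(J). For λ > 0 let 𝓔_λ be the collection of cubes Q ∈ 𝒟 with μ(Q) > 0 and μ(Q)^{-1} ∫_Q f dμ > λ. Then Σ_{Q∈𝓔_λ} w_Q ≤ C μ({x ∈ ℝ^d : M_μ f(x) > λ}), where M_μ f(x) = sup{ μ(I)^{-1} ∫_I f dμ : I ∈ 𝒟, x ∈ I, μ(I) > 0 } is the dyadic maximal function. -/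

import Mathlib

open MeasureTheory ENNReal Set

noncomputable section

/-- Index of a dyadic cube in `ℝ^d`: a pair `(k, m)` with `k : ℤ` the scale and
`m : Fin d → ℤ` the position; the cube is `2^{-k}(m + [0,1)^d)`. -/
abbrev DIdx (d : ℕ) := ℤ × (Fin d → ℤ)

/-- The dyadic cube `2^{-k}(m + [0,1)^d)` associated to an index. -/
def dyCube {d : ℕ} (I : DIdx d) : Set (Fin d → ℝ) :=
  {x | ∀ i, (I.2 i : ℝ) * (2 : ℝ) ^ (-I.1) ≤ x i ∧ x i < ((I.2 i : ℝ) + 1) * (2 : ℝ) ^ (-I.1)}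

/-- The average `μ(I)^{-1} ∫_I f dμ` of a nonnegative function over a dyadic cube. -/
def dyAvg {d : ℕ} (μ : Measure (Fin d → ℝ)) (f : (Fin d → ℝ) → ℝ) (I : DIdx d) : ℝ≥0∞ :=
  (μ (dyCube I))⁻¹ * ∫⁻ x in dyCube I, ENNReal.ofReal (f x) ∂μ

/-- The dyadic maximal function
`M_μ f (x) = sup{ μ(I)^{-1} ∫_I f dμ : I ∈ 𝒟, x ∈ I, μ(I) > 0 }`. -/
def dyMax {d : ℕ} (μ : Measure (Fin d → ℝ)) (f : (Fin d → ℝ) → ℝ) (x : Fin d → ℝ) : ℝ≥0∞ :=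
  ⨆ (I : DIdx d) (_ : x ∈ dyCube I) (_ : 0 < μ (dyCube I)), dyAvg μ f I

/-- Dyadic cubes are nested: a cube of finer scale that meets another cube is contained in it. -/
theorem dyCube_subset_of_mem {d : ℕ} {I J : DIdx d} (h : J.1 ≤ I.1) {x : Fin d → ℝ}
    (hI : x ∈ dyCube I) (hJ : x ∈ dyCube J) : dyCube I ⊆ dyCube J := by
  obtain ⟨k, m⟩ := I
  obtain ⟨l, n⟩ := J
  obtain ⟨p, rfl⟩ := Int.le.dest h
  have hr : (0 : ℝ) < 2 ^ (-(l + (p : ℤ))) := by positivity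
  have hl : (2 : ℝ) ^ (-l) = 2 ^ p * 2 ^ (-(l + (p : ℤ))) := by
    rw [← zpow_natCast, ← zpow_add₀ two_ne_zero]
    congr 1
    ring
  intro y hy i
  have hIi := hI i
  have hJi := hJ i
  have hyi := hy i
  simp only [hl] at hIi hJi hyi ⊢
  set r : ℝ := 2 ^ (-(l + (p : ℤ)))
  have h₁ : n i * 2 ^ p < m i + 1 := by
    have : (n i : ℝ) * 2 ^ p < m i + 1 := lt_of_mul_lt_mul_right (by linarith) hr.le
    exact_mod_cast this
  have h₂ : m i < (n i + 1) * 2 ^ p := by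
    have : (m i : ℝ) < (n i + 1) * 2 ^ p := lt_of_mul_lt_mul_right (by linarith) hr.le
    exact_mod_cast this
  have h₃ : (n i : ℝ) * 2 ^ p ≤ m i := by exact_mod_cast Int.lt_add_one_iff.mp h₁
  have h₄ : (m i : ℝ) + 1 ≤ (n i + 1) * 2 ^ p := by exact_mod_cast Int.add_one_le_iff.mpr h₂
  have h₅ := mul_le_mul_of_nonneg_right h₃ hr.le
  have h₆ := mul_le_mul_of_nonneg_right h₄ hr.le
  constructor <;> linarith

theorem measurableSet_dyCube {d : ℕ} (I : DIdx d) : MeasurableSet (dyCube I) := by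
  unfold dyCube
  measurability

open Classical in
/-- A Carleson family of weights, summed over finitely many dyadic cubes, is controlled by the
measure of the union of these cubes. -/
theorem sum_le_measure_biUnion_dyCube {d : ℕ} (μ : Measure (Fin d → ℝ)) (w : DIdx d → ℝ≥0∞)
    (C : ℝ≥0∞)
    (hCarl : ∀ J : DIdx d,
      ∑' I : {I : DIdx d // dyCube I ⊆ dyCube J}, w I.1 ≤ C * μ (dyCube J))
    (S : Finset (DIdx d)) : ∑ I ∈ S, w I ≤ C * μ (⋃ I ∈ S, dyCube I) := by
  induction S using Finset.strongInduction with
  | H S ih =>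
    rcases S.eq_empty_or_nonempty with rfl | hS
    · simp
    obtain ⟨J, hJ, hmin⟩ := S.exists_min_image Prod.fst hS
    set T := S.filter fun I => ¬ dyCube I ⊆ dyCube J
    have hTS : T ⊂ S := Finset.filter_ssubset.mpr ⟨J, hJ, by simp⟩
    have hdisj : Disjoint (dyCube J) (⋃ I ∈ T, dyCube I) := by
      simp only [disjoint_iUnion_right]
      intro I hI
      obtain ⟨hIS, hIJ⟩ := Finset.mem_filter.mp hI
      exact Set.disjoint_left.mpr fun x hxJ hxI =>
        hIJ (dyCube_subset_of_mem (hmin I hIS) hxI hxJ)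
    have hsub : ∑ I ∈ S with dyCube I ⊆ dyCube J, w I ≤ C * μ (dyCube J) := by
      refine le_trans ?_ (hCarl J)
      rw [← Finset.sum_subtype_eq_sum_filter]
      exact ENNReal.sum_le_tsum _
    calc ∑ I ∈ S, w I = ∑ I ∈ S with dyCube I ⊆ dyCube J, w I + ∑ I ∈ T, w I :=
          (Finset.sum_filter_add_sum_filter_not _ _ _).symm
      _ ≤ C * μ (dyCube J) + C * μ (⋃ I ∈ T, dyCube I) := add_le_add hsub (ih T hTS)
      _ = C * μ (dyCube J ∪ ⋃ I ∈ T, dyCube I) := by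
          rw [measure_union hdisj (T.measurableSet_biUnion fun I _ => measurableSet_dyCube I),
            mul_add]
      _ ≤ C * μ (⋃ I ∈ S, dyCube I) := by
          gcongr
          exact union_subset (subset_biUnion_of_mem (u := dyCube) (Finset.mem_coe.mpr hJ))
            (biUnion_subset_biUnion_left hTS.subset)

/-- **Level set comparison for Carleson sums.** If the weights `w_I` satisfy the Carleson
measure condition, then the sum of the weights of the cubes with average of `f` above `λ`
is controlled by `C` times the measure of the super-level set of the dyadic maximal
function. -/
theorem carleson_sum_le_maximal_level_set (d : ℕ) (μ : Measure (Fin d → ℝ))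
    [IsFiniteMeasureOnCompacts μ]
    (f : (Fin d → ℝ) → ℝ) (hf : Measurable f) (hf0 : 0 ≤ f)
    (w : DIdx d → ℝ≥0∞) (C : ℝ)
    (hCarl : ∀ J : DIdx d,
      ∑' I : {I : DIdx d // dyCube I ⊆ dyCube J}, w I.1 ≤ ENNReal.ofReal C * μ (dyCube J))
    (lam : ℝ) (hlam : 0 < lam) :
    ∑' Q : {Q : DIdx d // 0 < μ (dyCube Q) ∧ ENNReal.ofReal lam < dyAvg μ f Q}, w Q.1
      ≤ ENNReal.ofReal C * μ {x | ENNReal.ofReal lam < dyMax μ f x} := by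
  rw [ENNReal.tsum_eq_iSup_sum]
  refine iSup_le fun S => ?_
  refine (Finset.sum_map S (Function.Embedding.subtype _) w).symm.trans_le ?_
  refine (sum_le_measure_biUnion_dyCube μ w _ hCarl _).trans ?_
  gcongr
  refine iUnion₂_subset fun Q hQ x hx => ?_
  obtain ⟨⟨Q, hpos, hlt⟩, -, rfl⟩ := Finset.mem_map.mp hQ
  exact hlt.trans_le (le_iSup_of_le Q <| le_iSup₂_of_le hx hpos le_rfl)
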